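/- Let k ≤ n be positive integers, let D be a distribution on ordered k-tuples F = (x_1, …, x_k) of elements of F₂ⁿ, and let a strategy for the Hadamard subset tester consist of a unit vector ψ ∈ H_A ⊗ H_B (finite-dimensional Hilbert spaces) together with POVM families {M^{F,y}_{a,c,a'} : a, a' ∈ F₂^k, c ∈ F₂} for every pair (F, y) of a k-tuple F and a point y ∈ F₂ⁿ, {N^F_b : b ∈ F₂^k} for every k-tuple F of points of F₂ⁿ, and {N^y_d : d ∈ F₂} for every y ∈ F₂ⁿ. If this strategy passes the subset tester with probability at least 1 − ε, then there exist finite-dimensional Hilbert spaces H'_A and H'_B, a product unit vector aux = aux_A ⊗ aux_B ∈ H'_A ⊗ H'_B, and a projective measurement {Ĝ_u : u ∈ F₂ⁿ} on H_B ⊗ H'_B such that, writing ψ' = ψ ⊗ aux (with registers arranged as H_A ⊗ H'_A ⊗ H_B ⊗ H'_B), E_{F ∼ D} ∑_{a ∈ F₂^k} ‖ (N^F_a ⊗ I_{H'_A} ⊗ I_{H_B ⊗ H'_B}) ψ' − (I_{H_A ⊗ H'_A} ⊗ ∑_{u : u·x_i = a_i ∀ i ∈ [k]} Ĝ_u) ψ'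 ‖² ≤ (2k−1)² (45 + 12√k) √ε. -/

import Mathlib

open Finset Matrix ComplexOrder

noncomputable section

/-- Kronecker (tensor) product of two square matrices, on the product index type. -/
def kron {ι κ : Type} (M : Matrix ι ι ℂ) (N : Matrix κ κ ℂ) : Matrix (ι × κ) (ι × κ) ℂ :=
  fun r c => M r.1 c.1 * N r.2 c.2

/-- A POVM: a family of positive semidefinite operators summing to the identity. -/
def IsPOVM {α ι : Type} [Fintype α] [Fintype ι] [DecidableEq ι]
    (M : α → Matrix ι ι ℂ) : Prop :=
  (∀ a, (M a).PosSemidef) ∧ ∑ a, M a = 1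

/-- A projective measurement: a POVM all of whose elements are orthogonal projections. -/
def IsProjectiveMeas {α ι : Type} [Fintype α] [Fintype ι] [DecidableEq ι]
    (M : α → Matrix ι ι ℂ) : Prop :=
  IsPOVM M ∧ ∀ a, M a * M a = M a

/-- `⟨ψ| P ⊗ Q |ψ⟩` (real part). -/
def ipRe {ι κ : Type} [Fintype ι] [Fintype κ] (ψ : ι × κ → ℂ)
    (P : Matrix ι ι ℂ) (Q : Matrix κ κ ℂ) : ℝ :=
  (star ψ ⬝ᵥ (kron P Q).mulVec ψ).re

/-- `⟨ψ| · |ψ⟩` with the operator of player `b` (holding the first listed question) put on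
the tensor factor corresponding to that player: for `s = false` player 0 measures the
first factor; for `s = true` the roles are swapped. -/
def sideIP {ι : Type} [Fintype ι] (ψ : ι × ι → ℂ) (s : Bool)
    (P Q : Matrix ι ι ℂ) : ℝ :=
  if s then ipRe ψ Q P else ipRe ψ P Q

/-- The inner product `u·x = ∑ t u_t x_t` over `F₂`. -/
def dotF2 {n : ℕ} (u v : Fin n → ZMod 2) : ZMod 2 := ∑ t, u t * v t

section SubsetTester

variable {n k dd : ℕ}

/-- Answers of the long question `(F, y)`: `(a, c, a') ∈ F₂^k × F₂ × F₂^k`. -/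
abbrev LongAns (k : ℕ) := (Fin k → ZMod 2) × ZMod 2 × (Fin k → ZMod 2)

/-- The acceptance probability of one round of the subset tester, conditioned on the coin
`s`, the tuple `F` and the shift `y`. -/
def testerBody (ψ : (Fin dd × Fin dd) → ℂ)
    (M : (Fin k → (Fin n → ZMod 2)) → (Fin n → ZMod 2) → LongAns k → Matrix (Fin dd) (Fin dd) ℂ)
    (NF : (Fin k → (Fin n → ZMod 2)) → (Fin k → ZMod 2) → Matrix (Fin dd) (Fin dd) ℂ)
    (Ny : (Fin n → ZMod 2) → ZMod 2 → Matrix (Fin dd) (Fin dd) ℂ)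
    (s : Bool) (F : Fin k → (Fin n → ZMod 2)) (y : Fin n → ZMod 2) : ℝ :=
  (1/3) * ((1/3) *
      ((∑ t ∈ Finset.univ.filter (fun t : LongAns k => ∀ i, t.1 i + t.2.1 = t.2.2 i),
          sideIP ψ s (M F y t) (NF F t.1)) +
       (∑ t ∈ Finset.univ.filter (fun t : LongAns k => ∀ i, t.1 i + t.2.1 = t.2.2 i),
          sideIP ψ s (M F y t) (Ny y t.2.1)) +
       (∑ t ∈ Finset.univ.filter (fun t : LongAns k => ∀ i, t.1 i + t.2.1 = t.2.2 i),
          sideIP ψ s (M F y t) (NF (fun i => F i + y) t.2.2)))) +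
  (1/3) * ((1 / (k : ℝ)) * ∑ i : Fin k, ∑ a : Fin k → ZMod 2,
      sideIP ψ s (NF (fun j => F j + y) a) (Ny (F i + y) (a i))) +
  (1/3) * ((1/2) *
      ((∑ a : Fin k → ZMod 2, sideIP ψ s (NF F a) (NF F a)) +
       (1 / (k : ℝ)) * ∑ i : Fin k, ∑ e : ZMod 2,
          sideIP ψ s (Ny (F i + y) e) (Ny (F i + y) e)))

/-- The overall passing probability of the subset tester for a given strategy. -/
def testerAcc (D : (Fin k → (Fin n → ZMod 2)) → ℝ) (ψ : (Fin dd × Fin dd) → ℂ)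
    (M : (Fin k → (Fin n → ZMod 2)) → (Fin n → ZMod 2) → LongAns k → Matrix (Fin dd) (Fin dd) ℂ)
    (NF : (Fin k → (Fin n → ZMod 2)) → (Fin k → ZMod 2) → Matrix (Fin dd) (Fin dd) ℂ)
    (Ny : (Fin n → ZMod 2) → ZMod 2 → Matrix (Fin dd) (Fin dd) ℂ) : ℝ :=
  (1/2) * ∑ s : Bool, ∑ F : Fin k → (Fin n → ZMod 2), D F *
    ((∑ y : Fin n → ZMod 2, testerBody ψ M NF Ny s F y) / 2 ^ n)

end SubsetTester

section Expectation

variable {m : Type} [Fintype m]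

/-- The real-linear functional `X ↦ Re ⟨ψ| X |ψ⟩`. -/
def expVal (ψ : m → ℂ) : Matrix m m ℂ →ₗ[ℝ] ℝ where
  toFun X := (star ψ ⬝ᵥ X *ᵥ ψ).re
  map_add' X Y := by simp [add_mulVec, dotProduct_add]
  map_smul' r X := by simp [smul_mulVec, dotProduct_smul]

lemma expVal_apply (ψ : m → ℂ) (X : Matrix m m ℂ) :
    expVal ψ X = (star ψ ⬝ᵥ X *ᵥ ψ).re := rfl

lemma expVal_conjTranspose (ψ : m → ℂ) (X : Matrix m m ℂ) : expVal ψ Xᴴ = expVal ψ X := by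
  rw [expVal_apply, expVal_apply, star_dotProduct, star_mulVec, conjTranspose_conjTranspose,
    ← dotProduct_mulVec]
  exact Complex.conj_re _

lemma expVal_nonneg (ψ : m → ℂ) {X : Matrix m m ℂ} (hX : X.PosSemidef) : 0 ≤ expVal ψ X :=
  hX.re_dotProduct_nonneg ψ

lemma sum_norm_sq_mulVec (ψ : m → ℂ) (X : Matrix m m ℂ) :
    ∑ p, ‖(X *ᵥ ψ) p‖ ^ 2 = expVal ψ (Xᴴ * X) := by
  rw [expVal_apply, ← mulVec_mulVec, dotProduct_mulVec, ← star_mulVec, dotProduct, Complex.re_sum]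
  refine Finset.sum_congr rfl fun p _ => ?_
  simp [Complex.sq_norm, Complex.normSq_apply]

lemma expVal_one [DecidableEq m] (ψ : m → ℂ) : expVal ψ 1 = ∑ p, ‖ψ p‖ ^ 2 := by
  simpa using (sum_norm_sq_mulVec ψ 1).symm

/-- The weighted Cauchy–Schwarz inequality for the form `(X, Z) ↦ Re ⟨ψ| Xᴴ P Z |ψ⟩`. -/
lemma two_mul_expVal_le (ψ : m → ℂ) {P : Matrix m m ℂ} (hP : P.PosSemidef)
    (X Z : Matrix m m ℂ) {l : ℝ} (hl : 0 < l) :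
    2 * expVal ψ (Xᴴ * P * Z) ≤ l⁻¹ * expVal ψ (Xᴴ * P * X) + l * expVal ψ (Zᴴ * P * Z) := by
  have h := expVal_nonneg ψ (hP.conjTranspose_mul_mul_same (X - l • Z))
  have hs : expVal ψ (Zᴴ * P * X) = expVal ψ (Xᴴ * P * Z) := by
    rw [← expVal_conjTranspose]
    simp [conjTranspose_mul, hP.isHermitian.eq, Matrix.mul_assoc]
  have he : (X - l • Z)ᴴ * P * (X - l • Z) =
      Xᴴ * P * X - l • (Xᴴ * P * Z) - l • (Zᴴ * P * X) + (l * l) • (Zᴴ * P * Z) := by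
    simp [conjTranspose_sub, conjTranspose_smul, sub_mul, mul_sub, smul_smul]
    abel
  rw [he] at h
  simp only [map_add, map_sub, map_smul, smul_eq_mul, hs] at h
  have h' := mul_nonneg (inv_nonneg.2 hl.le) h
  have e : l⁻¹ * l = 1 := inv_mul_cancel₀ hl.ne'
  have : l⁻¹ * (expVal ψ (Xᴴ * P * X) - l * expVal ψ (Xᴴ * P * Z) - l * expVal ψ (Xᴴ * P * Z)
      + l * l * expVal ψ (Zᴴ * P * Z)) = l⁻¹ * expVal ψ (Xᴴ * P * X) -
      2 * (l⁻¹ * l) * expVal ψ (Xᴴ * P * Z) + (l⁻¹ * l) * l * expVal ψ (Zᴴ * P * Z) := by ring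
  rw [this, e] at h'
  linarith

end Expectation

section Observables

variable {m : Type} [DecidableEq m]

/-- A Hermitian contraction: an observable with spectrum in `[-1, 1]`. -/
def IsObservable (O : Matrix m m ℂ) : Prop := (1 - O).PosSemidef ∧ (1 + O).PosSemidef

lemma IsObservable.isHermitian {O : Matrix m m ℂ} (h : IsObservable O) : Oᴴ = O := by
  have := h.2.isHermitian.eq
  simpa [conjTranspose_add] using this

variable [Fintype m]

lemma posSemidef_sub_mul_self {P : Matrix m m ℂ} (h0 : P.PosSemidef) (h1 : (1 - P).PosSemidef) :
    (P - P * P).PosSemidef := by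
  have a := h1.conjTranspose_mul_mul_same P
  have b := h0.conjTranspose_mul_mul_same (1 - P)
  rw [h0.isHermitian.eq] at a
  rw [h1.isHermitian.eq] at b
  convert a.add b using 1
  noncomm_ring

lemma IsObservable.posSemidef_one_sub_mul_self {O : Matrix m m ℂ} (h : IsObservable O) :
    (1 - O * O).PosSemidef := by
  have a := h.1.conjTranspose_mul_mul_same (1 + O)
  have b := h.2.conjTranspose_mul_mul_same (1 - O)
  rw [h.2.isHermitian.eq] at a
  rw [h.1.isHermitian.eq] at b
  have := (a.add b).smul (show (0 : ℝ) ≤ 1 / 2 by norm_num)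
  convert this using 1
  rw [show (1 + O) * (1 - O) * (1 + O) + (1 - O) * (1 + O) * (1 - O) = (2 : ℝ) • (1 - O * O) by
    rw [two_smul]; noncomm_ring]
  rw [smul_smul]; norm_num

lemma IsObservable.expVal_conj_le {O : Matrix m m ℂ} (h : IsObservable O) (ψ : m → ℂ)
    (X : Matrix m m ℂ) : expVal ψ ((O * X)ᴴ * (O * X)) ≤ expVal ψ (Xᴴ * X) := by
  have := expVal_nonneg ψ (h.posSemidef_one_sub_mul_self.conjTranspose_mul_mul_same X)
  rw [show Xᴴ * (1 - O * O) * X = Xᴴ * X - (O * X)ᴴ * (O * X) by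
    rw [conjTranspose_mul, h.isHermitian]; noncomm_ring, map_sub] at this
  linarith

lemma IsObservable.expVal_mul_self_le {O : Matrix m m ℂ} (h : IsObservable O) (ψ : m → ℂ) :
    expVal ψ (O * O) ≤ expVal ψ 1 := by
  simpa [h.isHermitian] using h.expVal_conj_le ψ 1

/-- Two observables that are nearly perfectly correlated act almost identically on `ψ`. -/
lemma expVal_mul_swap_le {ψ : m → ℂ} (hψ : expVal ψ 1 = 1) {O O' X : Matrix m m ℂ}
    (h : IsObservable O) (h' : IsObservable O') (hX : expVal ψ (Xᴴ * X) ≤ 1)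
    {l : ℝ} (hl : 0 < l) :
    expVal ψ (Xᴴ * O) - expVal ψ (Xᴴ * O') ≤ l⁻¹ / 2 + l * (1 - expVal ψ (O * O')) := by
  have a := two_mul_expVal_le ψ PosSemidef.one X (O - O') hl
  have hs : expVal ψ (O' * O) = expVal ψ (O * O') := by
    rw [← expVal_conjTranspose, conjTranspose_mul, h.isHermitian, h'.isHermitian]
  have b := h.expVal_mul_self_le ψ
  have c := h'.expVal_mul_self_le ψ
  rw [hψ] at b c
  simp only [Matrix.mul_one, conjTranspose_sub, h.isHermitian, h'.isHermitian, mul_sub, sub_mul,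
    map_sub, hs] at a
  have hi : 0 < l⁻¹ := inv_pos.2 hl
  nlinarith [mul_le_mul_of_nonneg_left hX hi.le]

/-- An observable nearly perfectly correlated with the sign `s` of the outcome of a POVM may be
replaced by that sign once the POVM elements are inserted. -/
lemma expVal_sum_mul_swap_le {T : Type} [Fintype T] {ψ : m → ℂ} (hψ : expVal ψ 1 = 1)
    {M : T → Matrix m m ℂ} (hM : ∀ t, (M t).PosSemidef) (hM1 : ∑ t, M t = 1)
    {O X : Matrix m m ℂ} (h : IsObservable O) (hX : expVal ψ (Xᴴ * X) ≤ 1)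
    {s r : T → ℝ} (hs : ∀ t, s t ^ 2 = 1) (hr : ∀ t, r t ^ 2 = 1) {l : ℝ} (hl : 0 < l) :
    ∑ t, r t * expVal ψ (Xᴴ * M t * O) - ∑ t, r t * s t * expVal ψ (Xᴴ * M t)
      ≤ l⁻¹ / 2 + l * (1 - ∑ t, s t * expVal ψ (M t * O)) := by
  have key : ∀ t, 2 * (r t * expVal ψ (Xᴴ * M t * O) - r t * s t * expVal ψ (Xᴴ * M t)) ≤
      l⁻¹ * expVal ψ (Xᴴ * M t * X) + l * (expVal ψ (O * M t * O) -
        2 * (s t * expVal ψ (M t * O)) + expVal ψ (M t)) := by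
    intro t
    have a := two_mul_expVal_le ψ (hM t) X (r t • (O - s t • 1)) hl
    have hc : expVal ψ (O * M t) = expVal ψ (M t * O) := by
      rw [← expVal_conjTranspose, conjTranspose_mul, h.isHermitian, (hM t).isHermitian.eq]
    simp only [conjTranspose_smul, conjTranspose_sub, conjTranspose_one, h.isHermitian,
      star_trivial, mul_sub, sub_mul, smul_sub, smul_mul_assoc, mul_smul_comm, Matrix.mul_one,
      Matrix.one_mul, map_sub, map_smul, smul_eq_mul, hc] at a
    have e : r t * r t = 1 := by rw [← sq, hr]
    have e' : s t * s t = 1 := by rw [← sq, hs]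
    linear_combination a + l * (expVal ψ (O * M t * O) - 2 * (s t * expVal ψ (M t * O)) +
      s t * s t * expVal ψ (M t)) * e + l * expVal ψ (M t) * e'
  have S := Finset.sum_le_sum fun t (_ : t ∈ univ) => key t
  have e1 : ∑ t, expVal ψ (Xᴴ * M t * X) = expVal ψ (Xᴴ * X) := by
    rw [← map_sum, ← Finset.sum_mul, ← Finset.mul_sum, hM1, Matrix.mul_one]
  have e2 : ∑ t, expVal ψ (O * M t * O) = expVal ψ (O * O) := by
    rw [← map_sum, ← Finset.sum_mul, ← Finset.mul_sum, hM1, Matrix.mul_one]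
  have e3 : ∑ t, expVal ψ (M t) = 1 := by rw [← map_sum, hM1, hψ]
  have b := h.expVal_mul_self_le ψ
  rw [hψ] at b
  rw [← Finset.mul_sum, Finset.sum_sub_distrib, Finset.sum_add_distrib, ← Finset.mul_sum, e1,
    ← Finset.mul_sum, Finset.sum_add_distrib, Finset.sum_sub_distrib, e2, ← Finset.mul_sum, e3]
    at S
  have hi : 0 < l⁻¹ := inv_pos.2 hl
  nlinarith [mul_le_mul_of_nonneg_left hX hi.le]

/-- If two observables are close to the two outcome signs of a measurement `M`, and `Y` is close to
the product of these signs, then the product relation between the three holds on the state. -/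
lemma one_sub_expVal_mul_mul_le {T : Type} [Fintype T] {ψ : m → ℂ} (hψ : expVal ψ 1 = 1)
    {M : T → Matrix m m ℂ} (hM : ∀ t, (M t).PosSemidef) (hM1 : ∑ t, M t = 1)
    {NA NB N' Y YA YB : Matrix m m ℂ} (hNA : IsObservable NA) (hNB : IsObservable NB)
    (hN' : IsObservable N') (hY : IsObservable Y) (hYA : IsObservable YA) (hYB : IsObservable YB)
    (hcomm : ∀ t, M t * Y = Y * M t)
    {s s' : T → ℝ} (hs : ∀ t, s t ^ 2 = 1) (hs' : ∀ t, s' t ^ 2 = 1) {l : ℝ} (hl : 0 < l) :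
    1 - expVal ψ (NA * (Y * YB)) ≤ 5 / 2 * l⁻¹ +
      l * ((1 - expVal ψ (NA * NB)) + (1 - expVal ψ (YA * YB)) + (1 - expVal ψ (YA * N')) +
        (1 - ∑ t, s' t * expVal ψ (M t * N')) + (1 - ∑ t, s t * expVal ψ (M t * NB))) +
      (1 - ∑ t, s t * s' t * expVal ψ (M t * Y)) := by
  have hYN : expVal ψ ((Y * NB)ᴴ * (Y * NB)) ≤ 1 :=
    (hY.expVal_conj_le ψ _).trans (by simpa [hNB.isHermitian, hψ] using hNB.expVal_mul_self_le ψ)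
  have hYY : expVal ψ ((Y * YB)ᴴ * (Y * YB)) ≤ 1 :=
    (hY.expVal_conj_le ψ _).trans (by simpa [hYB.isHermitian, hψ] using hYB.expVal_mul_self_le ψ)
  have hY1 : expVal ψ (Yᴴ * Y) ≤ 1 := by
    simpa [hY.isHermitian, hψ] using hY.expVal_mul_self_le ψ
  -- swap `NA` for `NB` on the other side
  have a1 := expVal_mul_swap_le hψ hNB hNA hYY hl
  rw [← expVal_conjTranspose _ (_ * NB), ← expVal_conjTranspose _ (_ * NA)] at a1
  simp only [conjTranspose_mul (_)ᴴ, conjTranspose_conjTranspose, hNA.isHermitian,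
    hNB.isHermitian] at a1
  have c1 : expVal ψ (NB * NA) = expVal ψ (NA * NB) := by
    rw [← expVal_conjTranspose, conjTranspose_mul, hNA.isHermitian, hNB.isHermitian]
  -- swap `YB` for `YA`, then for the observable of the shifted tuple
  have a2 := expVal_mul_swap_le hψ hYA hYB hYN hl
  have a3 := expVal_mul_swap_le hψ hN' hYA hYN hl
  have c3 : expVal ψ (N' * YA) = expVal ψ (YA * N') := by
    rw [← expVal_conjTranspose, conjTranspose_mul, hYA.isHermitian, hN'.isHermitian]
  -- replace that observable by the second outcome sign of `M`
  have a4 := expVal_sum_mul_swap_le hψ hM hM1 hN' hYN hs' (r := fun _ => -1) (by simp) hl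
  have c4 : ∑ t, (-1 : ℝ) * expVal ψ ((Y * NB)ᴴ * M t * N') = - expVal ψ ((Y * NB)ᴴ * N') := by
    rw [← Finset.mul_sum, ← map_sum, ← Finset.sum_mul, ← Finset.mul_sum, hM1, Matrix.mul_one]
    ring
  -- replace `NB` by the first outcome sign of `M`
  have a5 := expVal_sum_mul_swap_le hψ hM hM1 hNB hY1 hs (r := fun t => - s' t)
    (by simpa using hs') hl
  have c5 : ∀ t, expVal ψ (Yᴴ * M t * NB) = expVal ψ ((Y * NB)ᴴ * M t) := by
    intro t
    rw [← expVal_conjTranspose]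
    simp only [conjTranspose_mul, hNB.isHermitian, hY.isHermitian, (hM t).isHermitian.eq, hcomm t,
      Matrix.mul_assoc]
  have c6 : ∀ t, expVal ψ (Yᴴ * M t) = expVal ψ (M t * Y) := by
    intro t
    rw [hY.isHermitian, hcomm t]
  rw [c1] at a1
  rw [c3] at a3
  simp only [c4] at a4
  simp only [c5, c6] at a5
  have d1 : expVal ψ (NB * (Y * YB)) = expVal ψ ((Y * NB)ᴴ * YB) := by
    rw [conjTranspose_mul, hNB.isHermitian, hY.isHermitian, Matrix.mul_assoc]
  have f4 : ∑ t, -1 * s' t * expVal ψ ((Y * NB)ᴴ * M t) =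
      - ∑ t, s' t * expVal ψ ((Y * NB)ᴴ * M t) := by
    rw [← Finset.sum_neg_distrib]; exact Finset.sum_congr rfl fun t _ => by ring
  have f5 : ∑ t, -s' t * expVal ψ ((Y * NB)ᴴ * M t) =
      - ∑ t, s' t * expVal ψ ((Y * NB)ᴴ * M t) := by
    rw [← Finset.sum_neg_distrib]; exact Finset.sum_congr rfl fun t _ => by ring
  have f6 : ∑ t, -s' t * s t * expVal ψ (M t * Y) = - ∑ t, s t * s' t * expVal ψ (M t * Y) := by
    rw [← Finset.sum_neg_distrib]; exact Finset.sum_congr rfl fun t _ => by ring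
  rw [f4] at a4
  rw [f5, f6] at a5
  linarith

end Observables

section Measurements

open scoped Kronecker

lemma kron_eq_kronecker {ι κ : Type} (P : Matrix ι ι ℂ) (Q : Matrix κ κ ℂ) :
    kron P Q = P ⊗ₖ Q := rfl

/-- The observable `∑ a, f a • P a` attached to a family of operators and real outcome values. -/
def obs {α ι : Type} [Fintype α] (f : α → ℝ) (P : α → Matrix ι ι ℂ) : Matrix ι ι ℂ :=
  ∑ a, f a • P a

variable {α β ι κ : Type} [Fintype α] [Fintype β] [Fintype ι] [Fintype κ]

lemma ipRe_eq_expVal (ψ : ι × κ → ℂ) (P : Matrix ι ι ℂ) (Q : Matrix κ κ ℂ) :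
    ipRe ψ P Q = expVal ψ (P ⊗ₖ Q) := rfl

/-- `ipRe` as a real bilinear map. -/
def ipReBilin (ψ : ι × κ → ℂ) : Matrix ι ι ℂ →ₗ[ℝ] Matrix κ κ ℂ →ₗ[ℝ] ℝ :=
  LinearMap.mk₂ ℝ (ipRe ψ)
    (fun P P' Q => by simp [ipRe_eq_expVal, add_kronecker])
    (fun r P Q => by simp [ipRe_eq_expVal, smul_kronecker])
    (fun P Q Q' => by simp [ipRe_eq_expVal, kronecker_add])
    (fun r P Q => by simp [ipRe_eq_expVal, kronecker_smul])

lemma ipReBilin_apply (ψ : ι × κ → ℂ) (P : Matrix ι ι ℂ) (Q : Matrix κ κ ℂ) :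
    ipReBilin ψ P Q = ipRe ψ P Q := rfl

lemma ipRe_obs_obs (ψ : ι × κ → ℂ) (f : α → ℝ) (g : β → ℝ) (P : α → Matrix ι ι ℂ)
    (Q : β → Matrix κ κ ℂ) :
    ipRe ψ (obs f P) (obs g Q) = ∑ a, ∑ b, f a * g b * ipRe ψ (P a) (Q b) := by
  rw [← ipReBilin_apply]
  simp only [obs, map_sum, map_smul, LinearMap.sum_apply, LinearMap.smul_apply, smul_eq_mul,
    ipReBilin_apply, Finset.mul_sum]
  rw [Finset.sum_comm]
  exact Finset.sum_congr rfl fun a _ => Finset.sum_congr rfl fun b _ => by ring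

lemma ipRe_sum_sum (ψ : ι × κ → ℂ) (P : α → Matrix ι ι ℂ) (Q : β → Matrix κ κ ℂ) :
    ipRe ψ (∑ a, P a) (∑ b, Q b) = ∑ a, ∑ b, ipRe ψ (P a) (Q b) := by
  simpa [obs] using ipRe_obs_obs ψ (fun _ => 1) (fun _ => 1) P Q

lemma ipRe_nonneg (ψ : ι × κ → ℂ) {P : Matrix ι ι ℂ} {Q : Matrix κ κ ℂ} (hP : P.PosSemidef)
    (hQ : Q.PosSemidef) : 0 ≤ ipRe ψ P Q :=
  expVal_nonneg ψ (hP.kronecker hQ)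

variable [DecidableEq ι] [DecidableEq κ]

lemma ipRe_one_one (ψ : ι × κ → ℂ) : ipRe ψ 1 1 = ∑ p, ‖ψ p‖ ^ 2 := by
  rw [ipRe_eq_expVal, one_kronecker_one, expVal_one]

lemma IsPOVM.isObservable_obs {P : α → Matrix ι ι ℂ} (hP : IsPOVM P) {f : α → ℝ}
    (hf : ∀ a, |f a| ≤ 1) : IsObservable (obs f P) := by
  constructor
  · rw [← hP.2, obs, ← Finset.sum_sub_distrib]
    refine posSemidef_sum _ fun a _ => ?_
    convert (hP.1 a).smul (sub_nonneg.2 (abs_le.1 (hf a)).2) using 1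
    rw [sub_smul, one_smul]
  · rw [← hP.2, obs, ← Finset.sum_add_distrib]
    refine posSemidef_sum _ fun a _ => ?_
    convert (hP.1 a).smul (show 0 ≤ 1 + f a by linarith [(abs_le.1 (hf a)).1]) using 1
    rw [add_smul, one_smul]

lemma IsObservable.kronecker_one {O : Matrix ι ι ℂ} (h : IsObservable O) :
    IsObservable (O ⊗ₖ (1 : Matrix κ κ ℂ)) := by
  constructor
  · rw [show 1 - O ⊗ₖ (1 : Matrix κ κ ℂ) = (1 - O) ⊗ₖ (1 : Matrix κ κ ℂ) by
      rw [sub_eq_iff_eq_add, ← add_kronecker, sub_add_cancel, one_kronecker_one]]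
    exact h.1.kronecker PosSemidef.one
  · rw [← one_kronecker_one, ← add_kronecker]
    exact h.2.kronecker PosSemidef.one

lemma IsObservable.one_kronecker {O : Matrix κ κ ℂ} (h : IsObservable O) :
    IsObservable ((1 : Matrix ι ι ℂ) ⊗ₖ O) := by
  constructor
  · rw [show 1 - (1 : Matrix ι ι ℂ) ⊗ₖ O = (1 : Matrix ι ι ℂ) ⊗ₖ (1 - O) by
      rw [sub_eq_iff_eq_add, ← kronecker_add, sub_add_cancel, one_kronecker_one]]
    exact PosSemidef.one.kronecker h.1
  · rw [← one_kronecker_one, ← kronecker_add]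
    exact PosSemidef.one.kronecker h.2

/-- The joint outcome distribution of two POVMs is normalized. -/
lemma sum_sum_ipRe_eq_one {ψ : ι × κ → ℂ} (hψ : ∑ p, ‖ψ p‖ ^ 2 = 1) {P : α → Matrix ι ι ℂ}
    {Q : β → Matrix κ κ ℂ} (hP : IsPOVM P) (hQ : IsPOVM Q) :
    ∑ a, ∑ b, ipRe ψ (P a) (Q b) = 1 := by
  rw [← ipRe_sum_sum, hP.2, hQ.2, ipRe_one_one, hψ]

/-- If a joint distribution `J` accepts only outcomes where `f` equals `1`, then the bias of `f`
is bounded by twice the rejection probability. -/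
lemma one_sub_bias_le {α β : Type} [Fintype α] [Fintype β] {J : α → β → ℝ}
    (hJ : ∀ a b, 0 ≤ J a b) (hJ1 : ∑ a, ∑ b, J a b = 1) {f : α → β → ℝ} (hf : ∀ a b, |f a b| ≤ 1)
    (S : Finset α) (g : α → β) (hfg : ∀ a ∈ S, f a (g a) = 1) :
    1 - ∑ a, ∑ b, f a b * J a b ≤ 2 * (1 - ∑ a ∈ S, J a (g a)) := by
  have hpos : ∀ a b, 0 ≤ (1 + f a b) * J a b := fun a b =>
    mul_nonneg (by linarith [(abs_le.1 (hf a b)).1]) (hJ a b)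
  have h : ∑ a ∈ S, 2 * J a (g a) ≤ ∑ a, ∑ b, (1 + f a b) * J a b :=
    calc ∑ a ∈ S, 2 * J a (g a) ≤ ∑ a ∈ S, ∑ b, (1 + f a b) * J a b := by
          refine Finset.sum_le_sum fun a ha => ?_
          have := Finset.single_le_sum (f := fun b => (1 + f a b) * J a b)
            (fun b _ => hpos a b) (Finset.mem_univ (g a))
          simp only [hfg a ha] at this
          linarith
      _ ≤ _ := Finset.sum_le_sum_of_subset_of_nonneg (Finset.subset_univ _)
          fun a _ _ => Finset.sum_nonneg fun b _ => hpos a b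
  simp only [add_mul, one_mul, Finset.sum_add_distrib, hJ1, ← Finset.mul_sum] at h
  linarith

lemma acc_le_one {α β : Type} [Fintype α] [Fintype β] {J : α → β → ℝ}
    (hJ : ∀ a b, 0 ≤ J a b) (hJ1 : ∑ a, ∑ b, J a b = 1) (S : Finset α) (g : α → β) :
    ∑ a ∈ S, J a (g a) ≤ 1 := by
  have := one_sub_bias_le hJ hJ1 (f := fun _ _ => 1) (by simp) S g (by simp)
  simp only [one_mul, hJ1] at this
  linarith

/-- Two POVMs with nearly perfectly correlated outcomes act almost identically on the state. -/
lemma sum_norm_sq_sub_le {ψ : ι × κ → ℂ} (hψ : ∑ p, ‖ψ p‖ ^ 2 = 1) {P : α → Matrix ι ι ℂ}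
    {Q : α → Matrix κ κ ℂ} (hP : IsPOVM P) (hQ : IsPOVM Q) :
    ∑ a, ∑ p, ‖((kron (P a) 1 - kron 1 (Q a)) *ᵥ ψ) p‖ ^ 2
      ≤ 2 * (1 - ∑ a, ipRe ψ (P a) (Q a)) := by
  classical
  have hle : ∀ {κ : Type} [Fintype κ] [DecidableEq κ] {Q : α → Matrix κ κ ℂ}, IsPOVM Q →
      ∀ a, (Q a - Q a * Q a).PosSemidef := by
    intro κ _ _ Q hQ a
    refine posSemidef_sub_mul_self (hQ.1 a) ?_
    rw [← hQ.2, ← Finset.add_sum_erase _ _ (Finset.mem_univ a), add_sub_cancel_left]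
    exact posSemidef_sum _ fun b _ => hQ.1 b
  have key : ∀ a, ∑ p, ‖((kron (P a) 1 - kron 1 (Q a)) *ᵥ ψ) p‖ ^ 2 ≤
      ipRe ψ (P a) 1 + ipRe ψ 1 (Q a) - 2 * ipRe ψ (P a) (Q a) := by
    intro a
    have hA := ipRe_nonneg ψ (hle hP a) (PosSemidef.one (n := κ) (R := ℂ))
    have hB := ipRe_nonneg ψ (PosSemidef.one (n := ι) (R := ℂ)) (hle hQ a)
    rw [← ipReBilin_apply] at hA hB
    simp only [map_sub, LinearMap.sub_apply, ipReBilin_apply] at hA hB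
    rw [sum_norm_sq_mulVec]
    simp only [kron_eq_kronecker, conjTranspose_sub, conjTranspose_kronecker, conjTranspose_one,
      (hP.1 a).isHermitian.eq, (hQ.1 a).isHermitian.eq, sub_mul, mul_sub, ← mul_kronecker_mul,
      Matrix.one_mul, Matrix.mul_one, map_sub, ← ipRe_eq_expVal]
    linarith
  refine (Finset.sum_le_sum fun a _ => key a).trans_eq ?_
  have h1 : ∑ a, ipRe ψ (P a) 1 = 1 := by
    simpa [ipReBilin_apply, hP.2, ipRe_one_one, hψ] using
      (congrArg (fun L => L 1) (map_sum (ipReBilin ψ) P univ)).symm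
  have h2 : ∑ a, ipRe ψ 1 (Q a) = 1 := by
    simpa [ipReBilin_apply, hQ.2, ipRe_one_one, hψ] using (map_sum (ipReBilin ψ 1) Q univ).symm
  rw [Finset.sum_sub_distrib, Finset.sum_add_distrib, h1, h2, ← Finset.mul_sum]
  ring

end Measurements

section Naimark

variable {U ι κ : Type} [Fintype U] [Fintype ι] [DecidableEq ι]

lemma IsProjectiveMeas.conj_unitary {P : U → Matrix ι ι ℂ} (hP : IsProjectiveMeas P)
    {W : Matrix ι ι ℂ} (hW : Wᴴ = W) (hWW : W * W = 1) :
    IsProjectiveMeas fun u => W * P u * W := by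
  refine ⟨⟨fun u => ?_, ?_⟩, fun u => ?_⟩
  · simpa [hW] using (hP.1.1 u).conjTranspose_mul_mul_same W
  · rw [← Finset.sum_mul, ← Finset.mul_sum, hP.1.2, Matrix.mul_one, hWW]
  · calc W * P u * W * (W * P u * W) = W * (P u * (W * W) * P u) * W := by noncomm_ring
      _ = W * P u * W := by rw [hWW, Matrix.mul_one, hP.2]

lemma IsProjectiveMeas.submatrix_equiv [Fintype κ] [DecidableEq κ] {P : U → Matrix ι ι ℂ}
    (hP : IsProjectiveMeas P) (e : κ ≃ ι) :
    IsProjectiveMeas fun u => (P u).submatrix e e := by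
  refine ⟨⟨fun u => (hP.1.1 u).submatrix e, ?_⟩, fun u => ?_⟩
  · have : ∑ u, (P u).submatrix e e = (∑ u, P u).submatrix e e := by
      ext i j
      simp [Matrix.sum_apply]
    rw [this, hP.1.2, submatrix_one_equiv]
  · rw [submatrix_mul_equiv, hP.2]

variable [DecidableEq U]

/-- The projective measurement of a label in the standard basis. -/
lemma isProjectiveMeas_diagonal (g : ι → U) :
    IsProjectiveMeas fun u => diagonal fun i => if g i = u then (1 : ℂ) else 0 := by
  refine ⟨⟨fun u => PosSemidef.diagonal fun i => ?_, ?_⟩, fun u => ?_⟩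
  · dsimp only [Pi.zero_apply]
    split_ifs <;> simp
  · ext i j
    rcases eq_or_ne i j with rfl | h
    · simp [Matrix.sum_apply]
    · simp [Matrix.sum_apply, h]
  · simp [diagonal_mul_diagonal]

/-- Naimark dilation: a POVM is the compression of a projective measurement on a larger space. -/
lemma exists_naimark_dilation [Inhabited U] {G : U → Matrix ι ι ℂ} (hG : IsPOVM G) :
    ∃ (d : ℕ) (j₀ : Fin d) (P : U → Matrix (ι × Fin d) (ι × Fin d) ℂ),
      IsProjectiveMeas P ∧ ∀ u, (P u).submatrix (fun i => (i, j₀)) (fun i => (i, j₀)) = G u := by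
  have hK : ∀ u, ∃ K : Matrix ι ι ℂ, G u = Kᴴ * K := fun u => by
    open scoped MatrixOrder in
    exact CStarAlgebra.nonneg_iff_eq_star_mul_self.1 (hG.1 u).nonneg
  choose K hK using hK
  let V : Matrix (U × ι) ι ℂ := of fun p j => K p.1 p.2 j
  have hV : ∀ u, Vᴴ * (diagonal fun p : U × ι => if p.1 = u then (1 : ℂ) else 0) * V = G u := by
    intro u
    rw [hK]
    ext i j
    rw [mul_apply, mul_apply, Fintype.sum_prod_type_right]
    simp [mul_diagonal, V]
  have hVV : Vᴴ * V = 1 := by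
    rw [← hG.2, Finset.sum_congr rfl fun u _ => (hV u).symm, ← Matrix.sum_mul, ← Matrix.mul_sum,
      (isProjectiveMeas_diagonal (fun p : U × ι => p.1)).1.2, Matrix.mul_one]
  let W : Matrix (ι ⊕ U × ι) (ι ⊕ U × ι) ℂ := fromBlocks 0 Vᴴ V (1 - V * Vᴴ)
  have hW : Wᴴ = W := by simp [W, fromBlocks_conjTranspose]
  have hWW : W * W = 1 := by
    have h1 : Vᴴ * (V * Vᴴ) = Vᴴ := by rw [← Matrix.mul_assoc, hVV, Matrix.one_mul]
    have h2 : V * Vᴴ * V = V := by rw [Matrix.mul_assoc, hVV, Matrix.mul_one]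
    have h3 : V * Vᴴ * (V * Vᴴ) = V * Vᴴ := by rw [← Matrix.mul_assoc, h2]
    simp [W, fromBlocks_multiply, hVV, Matrix.mul_sub, Matrix.sub_mul, h1, h2, h3]
  let g : ι ⊕ U × ι → U := Sum.elim (fun _ => default) Prod.fst
  let e : ι × Fin (Fintype.card (Option U)) ≃ ι ⊕ U × ι :=
    ((Equiv.refl ι).prodCongr (Fintype.equivFin (Option U)).symm).trans
      ((Equiv.prodComm _ _).trans optionProdEquiv)
  refine ⟨_, Fintype.equivFin (Option U) none, _,
    ((isProjectiveMeas_diagonal g).conj_unitary hW hWW).submatrix_equiv e, fun u => ?_⟩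
  have he : ∀ i, e (i, Fintype.equivFin (Option U) none) = Sum.inl i := fun i => by simp [e]
  have hD : (diagonal fun i => if g i = u then (1 : ℂ) else 0) =
      fromBlocks (diagonal fun _ => if default = u then (1 : ℂ) else 0) 0 0
        (diagonal fun p : U × ι => if p.1 = u then (1 : ℂ) else 0) := by
    rw [fromBlocks_diagonal]
    congr 1
    ext (i | i) <;> rfl
  rw [hD]
  ext i j
  rw [submatrix_apply, submatrix_apply, he, he, ← hV u]
  simp [W, fromBlocks_multiply, -fromBlocks_diagonal]

end Naimark

/-- Attaching product auxiliary states turns the expectation of `P ⊗ Q` into the expectation of the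
compression of `Q`. -/
lemma ipRe_attach_aux {ι κ : Type} [Fintype ι] [Fintype κ] {d : ℕ} (j₀ : Fin d) (ψ : ι × κ → ℂ)
    (P : Matrix ι ι ℂ) (Q : Matrix (κ × Fin d) (κ × Fin d) ℂ) :
    ipRe (fun q : (ι × Fin 1) × (κ × Fin d) =>
        ψ (q.1.1, q.2.1) * (fun _ => 1 : Fin 1 → ℂ) q.1.2 * (Pi.single j₀ 1 : Fin d → ℂ) q.2.2)
      (kron P 1) Q = ipRe ψ P (Q.submatrix (fun i => (i, j₀)) (fun i => (i, j₀))) := by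
  unfold ipRe
  congr 1
  simp [apply_ite, kron, dotProduct, mulVec, Fintype.sum_prod_type, Pi.single_apply]

section Fourier

/-- The nontrivial real character of `F₂`. -/
def sgn (a : ZMod 2) : ℝ := if a = 0 then 1 else -1

lemma sgn_zero : sgn 0 = 1 := if_pos rfl

lemma sgn_one : sgn 1 = -1 := if_neg one_ne_zero

lemma zmod_two_eq_zero_or_one : ∀ a : ZMod 2, a = 0 ∨ a = 1 := by decide

lemma sgn_add (a b : ZMod 2) : sgn (a + b) = sgn a * sgn b := by
  rcases zmod_two_eq_zero_or_one a with rfl | rfl <;>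
    rcases zmod_two_eq_zero_or_one b with rfl | rfl <;>
    simp [sgn_zero, sgn_one, CharTwo.add_self_eq_zero]

lemma sgn_sq (a : ZMod 2) : sgn a ^ 2 = 1 := by
  unfold sgn; split_ifs <;> norm_num

lemma abs_sgn (a : ZMod 2) : |sgn a| = 1 := by
  unfold sgn; split_ifs <;> norm_num

lemma sgn_mul_self (a : ZMod 2) : sgn a * sgn a = 1 := by
  rw [← sq, sgn_sq]

lemma abs_sgn_mul_sgn_le (a b : ZMod 2) : |sgn a * sgn b| ≤ 1 := by
  rw [abs_mul, abs_sgn, abs_sgn, one_mul]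

lemma sgn_mul_sgn_of_ne {a b : ZMod 2} (h : a ≠ b) : sgn a * sgn b = -1 := by
  rcases zmod_two_eq_zero_or_one a with rfl | rfl <;>
    rcases zmod_two_eq_zero_or_one b with rfl | rfl <;>
    simp_all [sgn_zero, sgn_one]

variable {n : ℕ}

lemma dotF2_add_left (u v w : Fin n → ZMod 2) : dotF2 (u + v) w = dotF2 u w + dotF2 v w := by
  simp [dotF2, add_mul, Finset.sum_add_distrib]

lemma dotF2_add_right (u v w : Fin n → ZMod 2) : dotF2 u (v + w) = dotF2 u v + dotF2 u w := by
  simp [dotF2, mul_add, Finset.sum_add_distrib]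

lemma dotF2_zero_right (u : Fin n → ZMod 2) : dotF2 u 0 = 0 := by simp [dotF2]

lemma sum_sgn_dotF2 (w : Fin n → ZMod 2) :
    ∑ u : Fin n → ZMod 2, sgn (dotF2 u w) = if w = 0 then 2 ^ n else 0 := by
  split_ifs with hw
  · subst hw
    simp [dotF2_zero_right, sgn_zero, ZMod.card]
  · obtain ⟨t, ht⟩ : ∃ t, w t ≠ 0 := by
      by_contra! h
      exact hw (funext h)
    have hs : sgn (dotF2 (Pi.single t 1) w) = -1 := by
      rw [sgn, if_neg]
      simpa [dotF2, Pi.single_apply] using ht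
    have h : ∑ u : Fin n → ZMod 2, sgn (dotF2 u w) =
        ∑ u : Fin n → ZMod 2, sgn (dotF2 (u + Pi.single t 1) w) :=
      (Equiv.sum_comp (Equiv.addRight (Pi.single t 1 : Fin n → ZMod 2))
        fun u => sgn (dotF2 u w)).symm
    simp only [dotF2_add_left, sgn_add, hs, ← Finset.sum_mul] at h
    linarith

variable {ι : Type} [Fintype ι]

/-- The operator-valued Fourier coefficient `E_y (-1)^(u·y) Y y`. -/
def fourierOp (Y : (Fin n → ZMod 2) → Matrix ι ι ℂ) (u : Fin n → ZMod 2) : Matrix ι ι ℂ :=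
  ((2 : ℝ) ^ n)⁻¹ • ∑ y, sgn (dotF2 u y) • Y y

lemma sum_sgn_smul_fourierOp_sq (Y : (Fin n → ZMod 2) → Matrix ι ι ℂ) (x : Fin n → ZMod 2) :
    ∑ u, sgn (dotF2 u x) • (fourierOp Y u * fourierOp Y u) =
      ((2 : ℝ) ^ n)⁻¹ • ∑ y, Y y * Y (x + y) := by
  have h2 : ((2 : ℝ) ^ n) ≠ 0 := by positivity
  have hexp : ∀ u, sgn (dotF2 u x) • (fourierOp Y u * fourierOp Y u) =
      ∑ y, ∑ z, (((2 : ℝ) ^ n)⁻¹ * ((2 : ℝ) ^ n)⁻¹ * sgn (dotF2 u (x + y + z))) • (Y y * Y z) := by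
    intro u
    simp only [fourierOp, smul_mul_assoc, mul_smul_comm, Finset.sum_mul, Finset.mul_sum,
      Finset.smul_sum, smul_smul, dotF2_add_right, sgn_add]
    rw [Finset.sum_comm]
    exact Finset.sum_congr rfl fun y _ => Finset.sum_congr rfl fun z _ => by congr 1; ring
  have hz : ∀ y z : Fin n → ZMod 2, x + y + z = 0 ↔ z = x + y := by
    intro y z
    constructor
    · intro h
      funext t
      have ht := congrFun h t
      simp only [Pi.add_apply, Pi.zero_apply] at ht ⊢
      rw [CharTwo.add_eq_zero] at ht
      exact ht.symm
    · rintro rfl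
      funext t
      exact CharTwo.add_self_eq_zero ((x + y) t)
  rw [Finset.sum_congr rfl fun u _ => hexp u, Finset.sum_comm, Finset.smul_sum]
  refine Finset.sum_congr rfl fun y _ => ?_
  rw [Finset.sum_comm]
  simp only [← Finset.sum_smul, ← Finset.mul_sum, sum_sgn_dotF2, hz]
  simp only [mul_ite, mul_zero, ite_smul, zero_smul, Finset.sum_ite_eq', Finset.mem_univ, if_true]
  rw [mul_assoc, inv_mul_cancel₀ h2, mul_one]

variable [DecidableEq ι]

/-- A family of observables indexed by `F₂ⁿ` yields a measurement of a linear function `u` whose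
signed marginals are the correlations `E_y Y y * Y (x + y)`, up to the defect of the `Y y` from
being unitary. -/
lemma exists_linear_povm {Y : (Fin n → ZMod 2) → Matrix ι ι ℂ} (hY : ∀ y, IsObservable (Y y)) :
    ∃ G : (Fin n → ZMod 2) → Matrix ι ι ℂ, IsPOVM G ∧ ∀ x,
      obs (fun u => sgn (dotF2 u x)) G =
        ((2 : ℝ) ^ n)⁻¹ • ∑ y, (Y y * Y (x + y) + (1 - Y y * Y y)) := by
  set R : Matrix ι ι ℂ := ((2 : ℝ) ^ n)⁻¹ • ∑ y, (1 - Y y * Y y) with hR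
  have hRpos : R.PosSemidef :=
    (posSemidef_sum _ fun y _ => (hY y).posSemidef_one_sub_mul_self).smul (by positivity)
  have hobs : ∀ x, obs (fun u => sgn (dotF2 u x))
      (fun u => fourierOp Y u * fourierOp Y u + if u = 0 then R else 0) =
        ((2 : ℝ) ^ n)⁻¹ • ∑ y, (Y y * Y (x + y) + (1 - Y y * Y y)) := by
    intro x
    have h0 : sgn (dotF2 (0 : Fin n → ZMod 2) x) = 1 := by simp [dotF2, sgn_zero]
    simp only [obs, smul_add, Finset.sum_add_distrib, sum_sgn_smul_fourierOp_sq, smul_ite,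
      smul_zero, Finset.sum_ite_eq', Finset.mem_univ, if_true, h0, one_smul]
    rw [hR]
  refine ⟨_, ⟨fun u => ?_, ?_⟩, hobs⟩
  · have hH : (fourierOp Y u)ᴴ = fourierOp Y u := by
      simp [fourierOp, conjTranspose_smul, conjTranspose_sum, (hY _).isHermitian]
    refine PosSemidef.add ?_ ?_
    · simpa [hH] using posSemidef_conjTranspose_mul_self (fourierOp Y u)
    · split_ifs
      exacts [hRpos, PosSemidef.zero]
  · have := hobs 0
    simp only [obs, dotF2_zero_right, sgn_zero, one_smul, zero_add, add_sub_cancel] at this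
    rw [this]
    simp only [Finset.sum_const, Finset.card_univ, Fintype.card_pi, ZMod.card, Finset.prod_const,
      Fintype.card_fin]
    rw [← Nat.cast_smul_eq_nsmul ℝ, smul_smul]
    simp

end Fourier

section UnionBound

variable {n k : ℕ} {ι κ : Type} [Fintype ι] [DecidableEq ι] [Fintype κ] [DecidableEq κ]

/-- The coarse-graining of a measurement of `u` to the values of `u` on a tuple of points. -/
lemma IsPOVM.restrict_dotF2 {G : (Fin n → ZMod 2) → Matrix κ κ ℂ} (hG : IsPOVM G)
    (F : Fin k → Fin n → ZMod 2) :
    IsPOVM fun a : Fin k → ZMod 2 =>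
      ∑ u ∈ univ.filter (fun u => ∀ i, dotF2 u (F i) = a i), G u := by
  refine ⟨fun a => posSemidef_sum _ fun u _ => hG.1 u, ?_⟩
  rw [← hG.2, ← Finset.sum_fiberwise univ (fun u i => dotF2 u (F i)) G]
  exact Finset.sum_congr rfl fun a _ => by simp only [funext_iff]

lemma one_sub_sum_ipRe_restrict_le {ψ : ι × κ → ℂ} (hψ : ∑ p, ‖ψ p‖ ^ 2 = 1)
    {P : (Fin k → ZMod 2) → Matrix ι ι ℂ} {G : (Fin n → ZMod 2) → Matrix κ κ ℂ} (hP : IsPOVM P)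
    (hG : IsPOVM G) (F : Fin k → Fin n → ZMod 2) :
    2 * (1 - ∑ a, ipRe ψ (P a) (∑ u ∈ univ.filter (fun u => ∀ i, dotF2 u (F i) = a i), G u)) ≤
      ∑ i, (1 - ipRe ψ (obs (fun a => sgn (a i)) P) (obs (fun u => sgn (dotF2 u (F i))) G)) := by
  have hJ : ∀ a u, 0 ≤ ipRe ψ (P a) (G u) := fun a u => ipRe_nonneg ψ (hP.1 a) (hG.1 u)
  have h1 := sum_sum_ipRe_eq_one hψ hP hG
  have hr : ∀ i, 1 - ipRe ψ (obs (fun a => sgn (a i)) P) (obs (fun u => sgn (dotF2 u (F i))) G) =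
      ∑ a, ∑ u, (1 - sgn (a i) * sgn (dotF2 u (F i))) * ipRe ψ (P a) (G u) := by
    intro i
    rw [ipRe_obs_obs]
    simp only [sub_mul, one_mul, Finset.sum_sub_distrib, h1]
  have hl : ∀ a, ipRe ψ (P a) (∑ u ∈ univ.filter (fun u => ∀ i, dotF2 u (F i) = a i), G u) =
      ∑ u, if ∀ i, dotF2 u (F i) = a i then ipRe ψ (P a) (G u) else 0 := by
    intro a
    rw [← ipReBilin_apply, map_sum, Finset.sum_filter]
    rfl
  rw [Finset.sum_congr rfl fun i _ => hr i, Finset.sum_congr rfl fun a _ => hl a]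
  conv_rhs => rw [Finset.sum_comm]
  conv_lhs => rw [← h1, ← Finset.sum_sub_distrib, Finset.mul_sum]
  refine Finset.sum_le_sum fun a _ => ?_
  conv_rhs => rw [Finset.sum_comm]
  rw [← Finset.sum_sub_distrib, Finset.mul_sum]
  refine Finset.sum_le_sum fun u _ => ?_
  have hpos : ∀ i, 0 ≤ (1 - sgn (a i) * sgn (dotF2 u (F i))) * ipRe ψ (P a) (G u) := fun i =>
    mul_nonneg (by linarith [(abs_le.1 (abs_sgn_mul_sgn_le (a i) (dotF2 u (F i)))).2]) (hJ a u)
  split_ifs with h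
  · rw [sub_self, mul_zero]
    exact Finset.sum_nonneg fun i _ => hpos i
  · push Not at h
    obtain ⟨i, hi⟩ := h
    have := Finset.single_le_sum (fun i _ => hpos i) (Finset.mem_univ i)
    rw [sgn_mul_sgn_of_ne hi.symm] at this
    linarith

end UnionBound

section Soundness

open scoped Kronecker

variable {α β ι κ : Type} [Fintype α] [Fintype β] [Fintype ι] [Fintype κ]

lemma ipRe_obs_left (ψ : ι × κ → ℂ) (f : α → ℝ) (P : α → Matrix ι ι ℂ) (Q : Matrix κ κ ℂ) :
    ipRe ψ (obs f P) Q = ∑ a, f a * ipRe ψ (P a) Q := by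
  rw [← ipReBilin_apply]
  simp only [obs, map_sum, map_smul, LinearMap.sum_apply, LinearMap.smul_apply, smul_eq_mul,
    ipReBilin_apply]

variable [DecidableEq ι] [DecidableEq κ]

lemma one_sub_ipRe_obs_obs_le {ψ : ι × κ → ℂ} (hψ : ∑ p, ‖ψ p‖ ^ 2 = 1)
    {P : α → Matrix ι ι ℂ} {Q : β → Matrix κ κ ℂ} (hP : IsPOVM P) (hQ : IsPOVM Q)
    {f : α → ℝ} {g : β → ℝ} (hf : ∀ a, |f a| ≤ 1) (hg : ∀ b, |g b| ≤ 1) (S : Finset α)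
    (r : α → β) (hr : ∀ a ∈ S, f a * g (r a) = 1) :
    1 - ipRe ψ (obs f P) (obs g Q) ≤ 2 * (1 - ∑ a ∈ S, ipRe ψ (P a) (Q (r a))) := by
  rw [ipRe_obs_obs]
  refine one_sub_bias_le (J := fun a b => ipRe ψ (P a) (Q b))
    (fun a b => ipRe_nonneg ψ (hP.1 a) (hQ.1 b)) (sum_sum_ipRe_eq_one hψ hP hQ) (fun a b => ?_)
    S r hr
  rw [abs_mul]
  exact mul_le_one₀ (hf a) (abs_nonneg _) (hg b)

lemma one_sub_ipRe_obs_obs_le' {ψ : ι × κ → ℂ} (hψ : ∑ p, ‖ψ p‖ ^ 2 = 1)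
    {P : α → Matrix ι ι ℂ} {Q : β → Matrix κ κ ℂ} (hP : IsPOVM P) (hQ : IsPOVM Q)
    {f : α → ℝ} {g : β → ℝ} (hf : ∀ a, |f a| ≤ 1) (hg : ∀ b, |g b| ≤ 1) (S : Finset β)
    (r : β → α) (hr : ∀ b ∈ S, f (r b) * g b = 1) :
    1 - ipRe ψ (obs f P) (obs g Q) ≤ 2 * (1 - ∑ b ∈ S, ipRe ψ (P (r b)) (Q b)) := by
  rw [ipRe_obs_obs, Finset.sum_comm]
  refine one_sub_bias_le (J := fun b a => ipRe ψ (P a) (Q b))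
    (fun b a => ipRe_nonneg ψ (hP.1 a) (hQ.1 b)) ?_ (f := fun b a => f a * g b) (fun b a => ?_)
    S r hr
  · rw [Finset.sum_comm, sum_sum_ipRe_eq_one hψ hP hQ]
  · rw [abs_mul]
    exact mul_le_one₀ (hf a) (abs_nonneg _) (hg b)

lemma sum_ipRe_le_one {ψ : ι × κ → ℂ} (hψ : ∑ p, ‖ψ p‖ ^ 2 = 1)
    {P : α → Matrix ι ι ℂ} {Q : β → Matrix κ κ ℂ} (hP : IsPOVM P) (hQ : IsPOVM Q)
    (S : Finset α) (r : α → β) : ∑ a ∈ S, ipRe ψ (P a) (Q (r a)) ≤ 1 :=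
  acc_le_one (fun a b => ipRe_nonneg ψ (hP.1 a) (hQ.1 b)) (sum_sum_ipRe_eq_one hψ hP hQ) S r

lemma sum_ipRe_le_one' {ψ : ι × κ → ℂ} (hψ : ∑ p, ‖ψ p‖ ^ 2 = 1)
    {P : α → Matrix ι ι ℂ} {Q : β → Matrix κ κ ℂ} (hP : IsPOVM P) (hQ : IsPOVM Q)
    (S : Finset β) (r : β → α) : ∑ b ∈ S, ipRe ψ (P (r b)) (Q b) ≤ 1 :=
  acc_le_one (J := fun b a => ipRe ψ (P a) (Q b)) (fun b a => ipRe_nonneg ψ (hP.1 a) (hQ.1 b))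
    (by rw [Finset.sum_comm, sum_sum_ipRe_eq_one hψ hP hQ]) S r

lemma one_sub_ipRe_one_mul_self_le {ψ : ι × κ → ℂ} (hψ : ∑ p, ‖ψ p‖ ^ 2 = 1)
    {X : Matrix ι ι ℂ} {Y : Matrix κ κ ℂ} (hX : IsObservable X) (hY : IsObservable Y) :
    1 - ipRe ψ 1 (Y * Y) ≤ 2 * (1 - ipRe ψ X Y) := by
  have h0 : 0 ≤ expVal ψ ((X ⊗ₖ 1 - 1 ⊗ₖ Y)ᴴ * (X ⊗ₖ (1 : Matrix κ κ ℂ) - 1 ⊗ₖ Y)) :=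
    expVal_nonneg ψ (posSemidef_conjTranspose_mul_self _)
  have h1 := (hX.kronecker_one (κ := κ)).expVal_mul_self_le ψ
  rw [expVal_one, hψ] at h1
  simp only [conjTranspose_sub, conjTranspose_kronecker, conjTranspose_one, hX.isHermitian,
    hY.isHermitian, sub_mul, mul_sub, ← mul_kronecker_mul, Matrix.one_mul, Matrix.mul_one,
    map_sub, ← ipRe_eq_expVal] at h0 h1
  linarith

lemma IsPOVM.kronecker_one {P : α → Matrix ι ι ℂ} (hP : IsPOVM P) :
    IsPOVM fun a => P a ⊗ₖ (1 : Matrix κ κ ℂ) := by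
  refine ⟨fun a => (hP.1 a).kronecker PosSemidef.one, ?_⟩
  rw [← one_kronecker_one, ← hP.2]
  ext ⟨i, j⟩ ⟨i₁, j₁⟩
  simp only [Matrix.sum_apply, kroneckerMap_apply, Finset.sum_mul]

variable {k : ℕ}

/-- The answers to a long question that pass its internal consistency check. -/
def validAns (k : ℕ) : Finset (LongAns k) :=
  univ.filter fun t => ∀ i, t.1 i + t.2.1 = t.2.2 i

lemma sgn_mul_sgn_of_mem_validAns {t : LongAns k} (ht : t ∈ validAns k) (i : Fin k) :
    sgn (t.1 i) * sgn (t.2.2 i) = sgn t.2.1 := by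
  rw [validAns, Finset.mem_filter] at ht
  rw [← ht.2 i, sgn_add, ← mul_assoc, sgn_mul_self, one_mul]

/-- If the measurements used for one choice of questions are nearly consistent, then the observable
of the `i`-th answer to the tuple is nearly the product of two point observables. -/
lemma one_sub_ipRe_obs_mul_obs_le {ψ : ι × ι → ℂ} (hψ : ∑ p, ‖ψ p‖ ^ 2 = 1)
    {M : LongAns k → Matrix ι ι ℂ} {N N' : (Fin k → ZMod 2) → Matrix ι ι ℂ}
    {Y Z : ZMod 2 → Matrix ι ι ℂ} (hM : IsPOVM M) (hN : IsPOVM N) (hN' : IsPOVM N')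
    (hY : IsPOVM Y) (hZ : IsPOVM Z) (i : Fin k) {l : ℝ} (hl : 1 ≤ l) :
    (1 - ipRe ψ (obs (fun a => sgn (a i)) N) (obs sgn Y * obs sgn Z)) +
        (1 - ipRe ψ 1 (obs sgn Z * obs sgn Z)) ≤
      5 / 2 * l⁻¹ + 36 * l *
        (((1 - ∑ t ∈ validAns k, ipRe ψ (M t) (N t.1)) +
          (1 - ∑ t ∈ validAns k, ipRe ψ (M t) (Y t.2.1)) +
          (1 - ∑ t ∈ validAns k, ipRe ψ (M t) (N' t.2.2))) / 18 +
        ((1 - ∑ a, ipRe ψ (Z (a i)) (N' a)) + (1 - ∑ a, ipRe ψ (N a) (N a)) +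
          (1 - ∑ e, ipRe ψ (Z e) (Z e))) / 6) := by
  have hsgn : ∀ b, |sgn b| ≤ 1 := fun b => (abs_sgn b).le
  have hsgi : ∀ a : Fin k → ZMod 2, |sgn (a i)| ≤ 1 := fun a => hsgn (a i)
  have hNO := hN.isObservable_obs hsgi
  have hNO' := hN'.isObservable_obs hsgi
  have hYO := hY.isObservable_obs hsgn
  have hZO := hZ.isObservable_obs hsgn
  have core := one_sub_expVal_mul_mul_le (ψ := ψ) (by rw [expVal_one, hψ])
    (hM.kronecker_one (κ := ι)).1 (hM.kronecker_one (κ := ι)).2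
    (hNO.kronecker_one (κ := ι)) (hNO.one_kronecker (ι := ι)) (hNO'.one_kronecker (ι := ι))
    (hYO.one_kronecker (ι := ι)) (hZO.kronecker_one (κ := ι)) (hZO.one_kronecker (ι := ι))
    (fun t => by simp only [← mul_kronecker_mul, Matrix.one_mul, Matrix.mul_one])
    (s := fun t => sgn (t.1 i)) (s' := fun t => sgn (t.2.2 i))
    (fun t => sgn_sq _) (fun t => sgn_sq _) (zero_lt_one.trans_le hl)
  simp only [← mul_kronecker_mul, Matrix.one_mul, Matrix.mul_one, ← ipRe_eq_expVal,
    ← ipRe_obs_left ψ (fun t : LongAns k => sgn (t.1 i)),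
    ← ipRe_obs_left ψ (fun t : LongAns k => sgn (t.2.2 i)),
    ← ipRe_obs_left ψ (fun t : LongAns k => sgn (t.1 i) * sgn (t.2.2 i))] at core
  have h11 := one_sub_ipRe_obs_obs_le hψ hM hN (fun t => hsgn (t.1 i)) hsgi (validAns k)
    (fun t => t.1) fun t _ => sgn_mul_self _
  have h12 := one_sub_ipRe_obs_obs_le hψ hM hY
    (f := fun t : LongAns k => sgn (t.1 i) * sgn (t.2.2 i)) (fun t => abs_sgn_mul_sgn_le _ _)
    hsgn (validAns k) (fun t => t.2.1) fun t ht => by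
      rw [sgn_mul_sgn_of_mem_validAns ht, sgn_mul_self]
  have h13 := one_sub_ipRe_obs_obs_le hψ hM hN' (fun t => hsgn (t.2.2 i)) hsgi (validAns k)
    (fun t => t.2.2) fun t _ => sgn_mul_self _
  have h2 := one_sub_ipRe_obs_obs_le' hψ hZ hN' hsgn hsgi univ (fun a => a i)
    fun t _ => sgn_mul_self _
  have h31 := one_sub_ipRe_obs_obs_le hψ hN hN hsgi hsgi univ id fun t _ => sgn_mul_self _
  have h32 := one_sub_ipRe_obs_obs_le hψ hZ hZ hsgn hsgn univ id fun t _ => sgn_mul_self _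
  have hsq := one_sub_ipRe_one_mul_self_le hψ hZO hZO
  have p12 := sum_ipRe_le_one hψ hM hY (validAns k) fun t => t.2.1
  have p2 := sum_ipRe_le_one' hψ hZ hN' univ fun a => a i
  have p31 := sum_ipRe_le_one hψ hN hN univ id
  have p32 := sum_ipRe_le_one hψ hZ hZ univ id
  simp only [id] at h31 h32 p31 p32
  have hl0 : 0 ≤ l := zero_le_one.trans hl
  have hsum := mul_le_mul_of_nonneg_left (add_le_add (add_le_add (add_le_add (add_le_add h31 h32)
    h2) h13) h11) hl0
  have m12 := mul_nonneg (sub_nonneg.2 hl) (sub_nonneg.2 p12)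
  have m2 := mul_nonneg hl0 (sub_nonneg.2 p2)
  have m31 := mul_nonneg hl0 (sub_nonneg.2 p31)
  have m32 := mul_nonneg (sub_nonneg.2 hl) (sub_nonneg.2 p32)
  linarith

variable {n : ℕ}

lemma one_sub_ipRe_average_le {ψ : ι × κ → ℂ} (hψ : ∑ p, ‖ψ p‖ ^ 2 = 1) {O : Matrix ι ι ℂ}
    (hO : IsObservable O) {Y : (Fin n → ZMod 2) → Matrix κ κ ℂ} (hY : ∀ y, IsObservable (Y y))
    (x : Fin n → ZMod 2) :
    1 - ipRe ψ O (((2 : ℝ) ^ n)⁻¹ • ∑ y, (Y y * Y (x + y) + (1 - Y y * Y y))) ≤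
      ((2 : ℝ) ^ n)⁻¹ * ∑ y, ((1 - ipRe ψ O (Y y * Y (x + y))) +
        (1 - ipRe ψ 1 (Y (x + y) * Y (x + y)))) := by
  have h2 : (0 : ℝ) < 2 ^ n := by positivity
  have hreindex : ∑ y, (1 - ipRe ψ 1 (Y (x + y) * Y (x + y))) =
      ∑ y, (1 - ipRe ψ 1 (Y y * Y y)) :=
    Equiv.sum_comp (Equiv.addLeft x) fun y => 1 - ipRe ψ 1 (Y y * Y y)
  have hone : (1 : ℝ) = ((2 : ℝ) ^ n)⁻¹ * ∑ _y : Fin n → ZMod 2, 1 := by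
    simp [ZMod.card]
  conv_rhs => rw [Finset.sum_add_distrib, hreindex, ← Finset.sum_add_distrib]
  rw [← ipReBilin_apply]
  simp only [map_smul, map_sum, smul_eq_mul, ipReBilin_apply]
  conv_lhs => rw [hone, ← mul_sub, ← Finset.sum_sub_distrib]
  refine mul_le_mul_of_nonneg_left (Finset.sum_le_sum fun y _ => ?_) (inv_nonneg.2 h2.le)
  have hpos := ipRe_nonneg ψ hO.2 (hY y).posSemidef_one_sub_mul_self
  have h1 := ipRe_one_one ψ
  rw [hψ] at h1
  rw [← ipReBilin_apply] at hpos ⊢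
  simp only [map_add, map_sub, LinearMap.add_apply, ipReBilin_apply] at hpos ⊢
  linarith

variable {dd : ℕ} {ψ : Fin dd × Fin dd → ℂ}
  {M : (Fin k → (Fin n → ZMod 2)) → (Fin n → ZMod 2) → LongAns k → Matrix (Fin dd) (Fin dd) ℂ}
  {NF : (Fin k → (Fin n → ZMod 2)) → (Fin k → ZMod 2) → Matrix (Fin dd) (Fin dd) ℂ}
  {Ny : (Fin n → ZMod 2) → ZMod 2 → Matrix (Fin dd) (Fin dd) ℂ}

/-- The rejection probabilities of the checks, summed over the coordinates, are controlled by the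
overall rejection probability for fixed `F` and `y`. -/
lemma sum_rejection_le (hk : 0 < k) (hψ : ∑ p, ‖ψ p‖ ^ 2 = 1)
    (hM : ∀ F y, IsPOVM (M F y)) (hNF : ∀ F, IsPOVM (NF F)) (hNy : ∀ y, IsPOVM (Ny y))
    (F : Fin k → (Fin n → ZMod 2)) (y : Fin n → ZMod 2) :
    ∑ i, (((1 - ∑ t ∈ validAns k, ipRe ψ (M F y t) (NF F t.1)) +
          (1 - ∑ t ∈ validAns k, ipRe ψ (M F y t) (Ny y t.2.1)) +
          (1 - ∑ t ∈ validAns k, ipRe ψ (M F y t) (NF (fun j => F j + y) t.2.2))) / 18 +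
        ((1 - ∑ a, ipRe ψ (Ny (F i + y) (a i)) (NF (fun j => F j + y) a)) +
          (1 - ∑ a, ipRe ψ (NF F a) (NF F a)) +
          (1 - ∑ e, ipRe ψ (Ny (F i + y) e) (Ny (F i + y) e))) / 6) ≤
      k * (1 - 1 / 2 * ∑ s, testerBody ψ M NF Ny s F y) := by
  have hk0 : (0 : ℝ) < k := Nat.cast_pos.2 hk
  have q11 := sum_ipRe_le_one' hψ (hNF F) (hM F y) (validAns k) fun t => t.1
  have q12 := sum_ipRe_le_one' hψ (hNy y) (hM F y) (validAns k) fun t => t.2.1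
  have q13 := sum_ipRe_le_one' hψ (hNF fun j => F j + y) (hM F y) (validAns k) fun t => t.2.2
  have q2 : 1 / (k : ℝ) * ∑ i, ∑ a, ipRe ψ (NF (fun j => F j + y) a) (Ny (F i + y) (a i)) ≤ 1 := by
    rw [one_div, inv_mul_le_iff₀ hk0, mul_one]
    refine (Finset.sum_le_card_nsmul univ _ 1 fun i _ =>
      sum_ipRe_le_one hψ (hNF fun j => F j + y) (hNy (F i + y)) univ fun a => a i).trans_eq ?_
    simp
  have hcancel : ∀ x : ℝ, ∃ r, x = k * r := fun x => ⟨x / k, by field_simp⟩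
  simp only [Fintype.sum_bool, testerBody, sideIP, if_true, Bool.false_eq_true, if_false,
    ← validAns.eq_def]
  simp only [Finset.sum_add_distrib, ← Finset.sum_div, Finset.sum_sub_distrib, Finset.sum_const,
    Finset.card_univ, Fintype.card_fin, nsmul_eq_mul, mul_one]
  obtain ⟨r, hr⟩ := hcancel (∑ i, ∑ a, ipRe ψ (Ny (F i + y) (a i)) (NF (fun j => F j + y) a))
  obtain ⟨r', hr'⟩ := hcancel (∑ i, ∑ e, ipRe ψ (Ny (F i + y) e) (Ny (F i + y) e))
  rw [hr, hr']
  simp only [one_div, inv_mul_cancel_left₀ hk0.ne'] at q2 ⊢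
  linarith [mul_le_mul_of_nonneg_left q11 hk0.le, mul_le_mul_of_nonneg_left q12 hk0.le,
    mul_le_mul_of_nonneg_left q13 hk0.le, mul_le_mul_of_nonneg_left q2 hk0.le]

lemma sum_one_sub_ipRe_linear_le (hk : 0 < k) (hψ : ∑ p, ‖ψ p‖ ^ 2 = 1)
    (hM : ∀ F y, IsPOVM (M F y)) (hNF : ∀ F, IsPOVM (NF F)) (hNy : ∀ y, IsPOVM (Ny y))
    {G : (Fin n → ZMod 2) → Matrix (Fin dd) (Fin dd) ℂ}
    (hG : ∀ x, obs (fun u => sgn (dotF2 u x)) G =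
      ((2 : ℝ) ^ n)⁻¹ • ∑ y, (obs sgn (Ny y) * obs sgn (Ny (x + y)) +
        (1 - obs sgn (Ny y) * obs sgn (Ny y))))
    (F : Fin k → (Fin n → ZMod 2)) {l : ℝ} (hl : 1 ≤ l) :
    ∑ i, (1 - ipRe ψ (obs (fun a => sgn (a i)) (NF F)) (obs (fun u => sgn (dotF2 u (F i))) G)) ≤
      k * (5 / 2 * l⁻¹ + 36 * l *
        (1 - 1 / 2 * ∑ s, (∑ y, testerBody ψ M NF Ny s F y) / 2 ^ n)) := by
  have h2 : (0 : ℝ) < 2 ^ n := by positivity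
  have hY : ∀ y, IsObservable (obs sgn (Ny y)) := fun y =>
    (hNy y).isObservable_obs fun b => (abs_sgn b).le
  simp only [hG]
  refine (Finset.sum_le_sum fun i _ => one_sub_ipRe_average_le hψ
    ((hNF F).isObservable_obs fun a => (abs_sgn (a i)).le) hY (F i)).trans ?_
  rw [← Finset.mul_sum, Finset.sum_comm, inv_mul_le_iff₀ h2]
  have hy : ∀ y, ∑ i, ((1 - ipRe ψ (obs (fun a => sgn (a i)) (NF F))
        (obs sgn (Ny y) * obs sgn (Ny (F i + y)))) +
        (1 - ipRe ψ 1 (obs sgn (Ny (F i + y)) * obs sgn (Ny (F i + y))))) ≤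
      k * (5 / 2 * l⁻¹ + 36 * l * (1 - 1 / 2 * ∑ s, testerBody ψ M NF Ny s F y)) := fun y => by
    refine (Finset.sum_le_sum fun i _ => one_sub_ipRe_obs_mul_obs_le hψ (hM F y) (hNF F)
      (hNF fun j => F j + y) (hNy y) (hNy (F i + y)) i hl).trans ?_
    have := mul_le_mul_of_nonneg_left (sum_rejection_le hk hψ hM hNF hNy F y)
      (show 0 ≤ 36 * l by linarith)
    rw [Finset.sum_add_distrib, Finset.sum_const, Finset.card_univ, Fintype.card_fin, nsmul_eq_mul,
      ← Finset.mul_sum]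
    linarith
  refine (Finset.sum_le_sum fun y _ => hy y).trans_eq ?_
  rw [← Finset.mul_sum, Finset.sum_add_distrib, Finset.sum_const, ← Finset.mul_sum,
    Finset.sum_sub_distrib, ← Finset.mul_sum, Finset.sum_comm, ← Finset.sum_div]
  simp only [Finset.sum_const, Finset.card_univ, Fintype.card_pi, ZMod.card, Finset.prod_const,
    Fintype.card_fin, nsmul_eq_mul, Nat.cast_pow, Nat.cast_ofNat]
  field_simp

lemma sum_weighted_le (hk : 0 < k) {ε : ℝ} {D : (Fin k → (Fin n → ZMod 2)) → ℝ}
    (hD0 : ∀ F, 0 ≤ D F) (hD1 : ∑ F, D F = 1) (hpass : 1 - ε ≤ testerAcc D ψ M NF Ny)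
    {c : (Fin k → (Fin n → ZMod 2)) → ℝ} {l : ℝ} (hl : 1 ≤ l)
    (hc : ∀ F, c F ≤ k * (5 / 2 * l⁻¹ + 36 * l *
        (1 - 1 / 2 * ∑ s, (∑ y, testerBody ψ M NF Ny s F y) / 2 ^ n))) :
    ∑ F, D F * c F ≤ k * (5 / 2 * l⁻¹ + 36 * l * ε) := by
  have hacc : testerAcc D ψ M NF Ny =
      1 / 2 * ∑ F, D F * ∑ s, (∑ y, testerBody ψ M NF Ny s F y) / 2 ^ n := by
    rw [testerAcc, Finset.sum_comm]
    simp only [← Finset.mul_sum]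
  have hk0 : (0 : ℝ) < k := Nat.cast_pos.2 hk
  calc ∑ F, D F * c F
      ≤ ∑ F, (D F * (k * (5 / 2 * l⁻¹ + 36 * l)) - k * (36 * l * (1 / 2)) *
          (D F * ∑ s, (∑ y, testerBody ψ M NF Ny s F y) / 2 ^ n)) :=
        Finset.sum_le_sum fun F _ =>
          (mul_le_mul_of_nonneg_left (hc F) (hD0 F)).trans_eq (by ring)
    _ = k * (5 / 2 * l⁻¹ + 36 * l * (1 - testerAcc D ψ M NF Ny)) := by
        rw [Finset.sum_sub_distrib, ← Finset.sum_mul, ← Finset.mul_sum, hD1, hacc]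
        ring
    _ ≤ _ := by gcongr; linarith

/-- Optimizing the free parameter `l` in a bound of the shape `k * (5 / 2 * l⁻¹ + 36 * l * ε)`. -/
lemma le_sqrt_of_forall_le (hk : 0 < k) {ε x : ℝ} (hε0 : 0 ≤ ε) (hε1 : ε < 1)
    (h : ∀ l : ℝ, 1 ≤ l → x ≤ k * (5 / 2 * l⁻¹ + 36 * l * ε)) :
    x ≤ (2 * (k : ℝ) - 1) ^ 2 * (45 + 12 * Real.sqrt k) * Real.sqrt ε := by
  have hk1 : (1 : ℝ) ≤ k := Nat.one_le_cast.2 hk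
  have hmain : x ≤ k * (77 / 2) * Real.sqrt ε := by
    rcases hε0.eq_or_lt with rfl | hε
    · rw [Real.sqrt_zero, mul_zero]
      by_contra! hx
      have := h (1 + 5 / 2 * k / x) (by linarith [show 0 ≤ 5 / 2 * k / x by positivity])
      have hpos : 0 < 1 + 5 / 2 * k / x := by positivity
      rw [mul_zero, add_zero, ← mul_assoc, ← div_eq_mul_inv, le_div_iff₀ hpos, mul_add,
        mul_div_cancel₀ _ hx.ne'] at this
      linarith
    · have hs : 0 < Real.sqrt ε := Real.sqrt_pos.2 hε
      have hs1 : Real.sqrt ε ≤ 1 := Real.sqrt_le_one.2 hε1.le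
      have := h (Real.sqrt ε)⁻¹ ((one_le_inv₀ hs).2 hs1)
      have hss : (Real.sqrt ε)⁻¹ * ε = Real.sqrt ε := by
        rw [inv_mul_eq_div, Real.div_sqrt]
      rw [inv_inv, mul_assoc 36, hss] at this
      linarith
  refine hmain.trans (mul_le_mul_of_nonneg_right ?_ (Real.sqrt_nonneg ε))
  have hk2 : (k : ℝ) ≤ (2 * (k : ℝ) - 1) ^ 2 := by nlinarith
  exact mul_le_mul hk2 (by linarith [Real.sqrt_nonneg (k : ℝ)]) (by norm_num) (sq_nonneg _)

end Soundness


/-- quantum soundness of the subset tester for the Hadamard code. -/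
theorem stmt17 (k n dd : ℕ) (hk : 0 < k) (hkn : k ≤ n) (hdd : 0 < dd)
    (ε : ℝ) (hε0 : 0 ≤ ε) (hε1 : ε < 1)
    (D : (Fin k → (Fin n → ZMod 2)) → ℝ)
    (hD0 : ∀ F, 0 ≤ D F) (hD1 : ∑ F : Fin k → (Fin n → ZMod 2), D F = 1)
    (ψ : (Fin dd × Fin dd) → ℂ) (hψ : ∑ p, ‖ψ p‖ ^ 2 = 1)
    (M : (Fin k → (Fin n → ZMod 2)) → (Fin n → ZMod 2) → LongAns k →
      Matrix (Fin dd) (Fin dd) ℂ)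
    (NF : (Fin k → (Fin n → ZMod 2)) → (Fin k → ZMod 2) → Matrix (Fin dd) (Fin dd) ℂ)
    (Ny : (Fin n → ZMod 2) → ZMod 2 → Matrix (Fin dd) (Fin dd) ℂ)
    (hM : ∀ F y, IsPOVM (M F y)) (hNF : ∀ F, IsPOVM (NF F)) (hNy : ∀ y, IsPOVM (Ny y))
    (hpass : 1 - ε ≤ testerAcc D ψ M NF Ny) :
    ∃ (dA' dB' : ℕ) (_ : 0 < dA') (_ : 0 < dB')
      (auxA : Fin dA' → ℂ) (auxB : Fin dB' → ℂ)
      (Ghat : (Fin n → ZMod 2) → Matrix (Fin dd × Fin dB') (Fin dd × Fin dB') ℂ),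
      (∑ i, ‖auxA i‖ ^ 2 = 1) ∧ (∑ i, ‖auxB i‖ ^ 2 = 1) ∧
      IsProjectiveMeas Ghat ∧
      (∑ F : Fin k → (Fin n → ZMod 2), D F * ∑ a : Fin k → ZMod 2, ∑ p,
        ‖((kron (kron (NF F a) (1 : Matrix (Fin dA') (Fin dA') ℂ))
              (1 : Matrix (Fin dd × Fin dB') (Fin dd × Fin dB') ℂ) -
            kron (1 : Matrix (Fin dd × Fin dA') (Fin dd × Fin dA') ℂ)
              (∑ u ∈ Finset.univ.filter
                  (fun u : Fin n → ZMod 2 => ∀ i, dotF2 u (F i) = a i),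
                Ghat u)).mulVec
          (fun q : (Fin dd × Fin dA') × (Fin dd × Fin dB') =>
            ψ (q.1.1, q.2.1) * auxA q.1.2 * auxB q.2.2)) p‖ ^ 2
        ≤ (2 * (k : ℝ) - 1) ^ 2 * (45 + 12 * Real.sqrt k) * Real.sqrt ε) := by
  have hY : ∀ y, IsObservable (obs sgn (Ny y)) := fun y =>
    (hNy y).isObservable_obs fun b => (abs_sgn b).le
  obtain ⟨G, hG, hGobs⟩ := exists_linear_povm hY
  obtain ⟨d, j₀, Ghat, hGhat, hsub⟩ := exists_naimark_dilation hG
  have hψ' : ∑ q : (Fin dd × Fin 1) × (Fin dd × Fin d), ‖ψ (q.1.1, q.2.1) *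
      (fun _ => 1 : Fin 1 → ℂ) q.1.2 * (Pi.single j₀ 1 : Fin d → ℂ) q.2.2‖ ^ 2 = 1 := by
    have hinj : Function.Injective fun i : Fin dd => (i, j₀) := fun _ _ h => congrArg Prod.fst h
    rw [← ipRe_one_one]
    have h := ipRe_attach_aux j₀ ψ 1 1
    rw [kron_eq_kronecker, one_kronecker_one, submatrix_one _ hinj, ipRe_one_one ψ, hψ] at h
    exact h
  refine ⟨1, d, one_pos, j₀.pos, fun _ => 1, Pi.single j₀ 1, Ghat, by simp,
    by simp [Pi.single_apply, apply_ite], hGhat, ?_⟩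
  refine le_sqrt_of_forall_le hk hε0 hε1 fun l hl => sum_weighted_le hk hD0 hD1 hpass hl fun F => ?_
  refine le_trans ?_ (sum_one_sub_ipRe_linear_le hk hψ hM hNF hNy hGobs F hl)
  refine le_trans ?_ (one_sub_sum_ipRe_restrict_le hψ (hNF F) hG F)
  refine (sum_norm_sq_sub_le hψ' (hNF F).kronecker_one (hGhat.1.restrict_dotF2 F)).trans_eq ?_
  congr 2
  refine Finset.sum_congr rfl fun a _ => ?_
  refine (ipRe_attach_aux j₀ ψ _ _).trans ?_
  congr 1
  ext i j
  simp only [submatrix_apply, Matrix.sum_apply, ← hsub]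

end
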